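/- For every ℓ > 0 and every smooth function f : 𝕋²_ℓ → ℝ, the Fourier and real-space representations of the squared homogeneous H^{1/2} seminorm agree: (1/ℓ²) Σ_{k ∈ (2π/ℓ)ℤ²} |k| |f̂_k|² = (1/(4π)) ∫_{𝕋²_ℓ} ∫_{ℝ²} |f(x) − f(y)|²/|x−y|³ dy dx, where f̂_k = ∫_{𝕋²_ℓ} e^{−i k·x} f(x) dx are the Fourier coefficients of f. -/

import Mathlib

open MeasureTheory Real

noncomputable section
/-- The plane `ℝ²`, modeled as functions `Fin 2 → ℝ`. -/
abbrev R2 : Type := Fin 2 → ℝ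

/-- A fundamental domain for the torus `𝕋²_ℓ = ℝ²/ℓℤ²` of side length `ℓ`. -/
def cubeL (ℓ : ℝ) : Set R2 := Set.univ.pi fun _ => Set.Ico (0 : ℝ) ℓ

/-- `ℓℤ²`-periodicity: functions on the torus `𝕋²_ℓ`. -/
def PerL (ℓ : ℝ) (f : R2 → ℝ) : Prop :=
  ∀ (x : R2) (n : Fin 2 → ℤ), f (x + fun i => ℓ * (n i : ℝ)) = f x

/-- The Euclidean norm on `ℝ²`. -/
def en2 (z : R2) : ℝ := Real.sqrt (∑ i, z i ^ 2)

/-- The Fourier coefficient `f̂_k = ∫_{𝕋²_ℓ} e^{-i k·x} f(x) dx`. -/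
def fourierCoeffL (ℓ : ℝ) (f : R2 → ℝ) (k : R2) : ℂ :=
  ∫ x in cubeL ℓ, Complex.exp (-Complex.I * ((∑ i, k i * x i : ℝ) : ℂ)) * (f x : ℂ)

lemma lint_Ioi {F F' : ℝ → ℝ} {m : ℝ} (h : ∀ x ∈ Set.Ici (0:ℝ), HasDerivAt F (F' x) x)
    (hp : ∀ x ∈ Set.Ioi (0:ℝ), 0 ≤ F' x) (hl : Filter.Tendsto F Filter.atTop (nhds m)) :
    ∫⁻ x in Set.Ioi (0:ℝ), ENNReal.ofReal (F' x) = ENNReal.ofReal (m - F 0) := by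
  rw [← integral_Ioi_of_hasDerivAt_of_nonneg' h hp hl, ofReal_integral_eq_lintegral_ofReal]
  · exact integrableOn_Ioi_deriv_of_nonneg' h hp hl
  · exact (ae_restrict_iff' measurableSet_Ioi).2 (Filter.Eventually.of_forall hp)

lemma lint_texp {r : ℝ} (hr : 0 < r) :
    ∫⁻ t in Set.Ioi (0:ℝ), ENNReal.ofReal (t * exp (-(r * t))) = ENNReal.ofReal (1 / r ^ 2) := by
  have h := Real.integral_rpow_mul_exp_neg_mul_Ioi (a := 2) (r := r) (by norm_num) hr
  have e : (2:ℝ) - 1 = 1 := by norm_num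
  simp only [e, rpow_one, Real.Gamma_two, mul_one, rpow_two] at h
  have hi : IntegrableOn (fun t : ℝ => t * exp (-(r * t))) (Set.Ioi 0) := by
    by_contra hc
    rw [integral_undef hc] at h
    have : 0 < (1 / r) ^ 2 := by positivity
    linarith
  rw [← ofReal_integral_eq_lintegral_ofReal hi, h, one_div_pow]
  exact (ae_restrict_iff' measurableSet_Ioi).2 (Filter.Eventually.of_forall fun t ht => by
    have : 0 < t := ht
    positivity)

lemma lint_cosexp {a t : ℝ} (ht : 0 < t) :
    ∫⁻ r in Set.Ioi (0:ℝ), ENNReal.ofReal ((2 - 2 * cos (a * r)) * exp (-(r * t)))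
      = ENNReal.ofReal (2 * a ^ 2 / (t * (t ^ 2 + a ^ 2))) := by
  have hne : t ^ 2 + a ^ 2 ≠ 0 := by positivity
  have := lint_Ioi (F := fun r => exp (-(r * t)) * (-(2 / t) + 2 * (t * cos (a * r) - a * sin (a * r)) / (t ^ 2 + a ^ 2)))
    (F' := fun r => (2 - 2 * cos (a * r)) * exp (-(r * t))) (m := 0) ?_ ?_ ?_
  · rw [this]
    congr 1
    simp
    field_simp
    ring
  · intro r _
    have h1 : HasDerivAt (fun r : ℝ => exp (-(r * t))) (exp (-(r * t)) * (-(1 * t))) r :=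
      (((hasDerivAt_id r).mul_const t).neg).exp
    have h0 : HasDerivAt (fun r : ℝ => a * r) (a * 1) r := (hasDerivAt_id r).const_mul a
    have h2 := ((((h0.cos.const_mul t).sub (h0.sin.const_mul a)).const_mul 2).div_const (t ^ 2 + a ^ 2)).const_add (-(2/t))
    refine (h1.mul h2).congr_deriv ?_
    simp only [Pi.sub_apply]
    field_simp
    ring
  · intro r _
    have := cos_le_one (a * r)
    have := exp_pos (-(r * t))
    apply mul_nonneg <;> linarith
  · apply squeeze_zero_norm (a := fun r => exp (-(r * t)) * (2 / t + 2 * (t + |a|) / (t ^ 2 + a ^ 2)))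
    · intro r
      rw [norm_mul, Real.norm_eq_abs, abs_of_pos (exp_pos _)]
      gcongr
      refine (norm_add_le _ _).trans ?_
      gcongr
      · rw [norm_neg, Real.norm_eq_abs, abs_of_pos (by positivity)]
      · rw [norm_div, Real.norm_of_nonneg (by positivity : 0 ≤ t ^ 2 + a ^ 2)]
        gcongr
        rw [norm_mul, Real.norm_of_nonneg (by norm_num : (0:ℝ) ≤ 2)]
        gcongr
        refine (norm_sub_le _ _).trans ?_
        rw [norm_mul, norm_mul, Real.norm_eq_abs, Real.norm_eq_abs, Real.norm_eq_abs, Real.norm_eq_abs, abs_of_pos ht]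
        have := abs_cos_le_one (a * r)
        have := abs_sin_le_one (a * r)
        have := abs_nonneg a
        nlinarith
    · have : Filter.Tendsto (fun r : ℝ => exp (-(r * t))) Filter.atTop (nhds 0) :=
        tendsto_exp_neg_atTop_nhds_zero.comp (Filter.tendsto_id.atTop_mul_const ht)
      simpa using this.mul_const (2 / t + 2 * (t + |a|) / (t ^ 2 + a ^ 2))

lemma lint_arctan {a : ℝ} (ha : 0 < a) :
    ∫⁻ t in Set.Ioi (0:ℝ), ENNReal.ofReal (2 * a ^ 2 / (t ^ 2 + a ^ 2)) = ENNReal.ofReal (π * a) := by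
  have := lint_Ioi (F := fun t => 2 * a * arctan (t / a))
    (F' := fun t => 2 * a ^ 2 / (t ^ 2 + a ^ 2)) (m := 2 * a * (π / 2)) ?_ ?_ ?_
  · rw [this]; congr 1; simp; ring
  · intro t _
    have h := ((((hasDerivAt_id t).div_const a)).arctan).const_mul (2 * a)
    refine h.congr_deriv ?_
    simp only [id]
    field_simp
    ring
  · intro t _; positivity
  · apply Filter.Tendsto.const_mul
    exact (tendsto_nhds_of_tendsto_nhdsWithin tendsto_arctan_atTop).comp
      (Filter.tendsto_id.atTop_div_const ha)

lemma lint_cos_pos {a : ℝ} (ha : 0 < a) :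
    ∫⁻ r in Set.Ioi (0:ℝ), ENNReal.ofReal ((2 - 2 * cos (a * r)) / r ^ 2) = ENNReal.ofReal (π * a) := by
  have hc : ∀ r, 0 ≤ 2 - 2 * cos (a * r) := fun r => by linarith [cos_le_one (a * r)]
  calc _ = ∫⁻ r in Set.Ioi (0:ℝ), ∫⁻ t in Set.Ioi (0:ℝ), ENNReal.ofReal ((2 - 2 * cos (a * r)) * (t * exp (-(r * t)))) := by
        refine setLIntegral_congr_fun measurableSet_Ioi fun r hr => ?_
        simp only [ENNReal.ofReal_mul (hc r)]
        rw [lintegral_const_mul _ (by fun_prop), lint_texp hr, ← ENNReal.ofReal_mul (hc r)]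
        congr 1; ring
    _ = ∫⁻ t in Set.Ioi (0:ℝ), ∫⁻ r in Set.Ioi (0:ℝ), ENNReal.ofReal ((2 - 2 * cos (a * r)) * (t * exp (-(r * t)))) := by
        rw [lintegral_lintegral_swap]
        apply Measurable.aemeasurable
        unfold Function.uncurry
        fun_prop
    _ = _ := by
        rw [← lint_arctan ha]
        refine setLIntegral_congr_fun measurableSet_Ioi fun t ht => ?_
        have ht : 0 < t := ht
        have : ∀ r, ENNReal.ofReal ((2 - 2 * cos (a * r)) * (t * exp (-(r * t)))) = ENNReal.ofReal t * ENNReal.ofReal ((2 - 2 * cos (a * r)) * exp (-(r * t))) := by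
          intro r
          rw [← ENNReal.ofReal_mul ht.le]; congr 1; ring
        simp only [this]
        rw [lintegral_const_mul _ (by fun_prop), lint_cosexp ht, ← ENNReal.ofReal_mul ht.le]
        congr 1; field_simp

lemma lint_cos (a : ℝ) :
    ∫⁻ r in Set.Ioi (0:ℝ), ENNReal.ofReal ((2 - 2 * cos (a * r)) / r ^ 2) = ENNReal.ofReal (π * |a|) := by
  rcases lt_trichotomy a 0 with h | h | h
  · rw [abs_of_neg h, ← lint_cos_pos (neg_pos.2 h)]
    simp
  · simp [h]
  · rw [abs_of_pos h, lint_cos_pos h]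

lemma int_abs_cos (φ : ℝ) : ∫ θ in (-π)..π, |cos (θ - φ)| = 4 := by
  rw [intervalIntegral.integral_comp_sub_right (fun x => |cos x|) φ]
  have hp : Function.Periodic (fun x => |cos x|) (2 * π) := fun x => by simp
  have h := hp.intervalIntegral_add_eq (-π - φ) (-(π / 2))
  have e1 : -π - φ + 2 * π = π - φ := by ring
  rw [e1] at h
  rw [h]
  have hi : ∀ a b : ℝ, IntervalIntegrable (fun x => |cos x|) volume a b :=
    fun a b => (continuous_cos.abs).intervalIntegrable a b
  rw [← intervalIntegral.integral_add_adjacent_intervals (hi _ (π / 2)) (hi _ _)]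
  have h1 : ∫ x in (-(π / 2))..(π / 2), |cos x| = ∫ x in (-(π / 2))..(π / 2), cos x := by
    apply intervalIntegral.integral_congr
    intro x hx
    rw [Set.uIcc_of_le (by linarith [pi_pos])] at hx
    exact abs_of_nonneg (cos_nonneg_of_mem_Icc hx)
  have h2 : ∫ x in (π / 2)..(-(π / 2) + 2 * π), |cos x| = ∫ x in (π / 2)..(-(π / 2) + 2 * π), -cos x := by
    apply intervalIntegral.integral_congr
    intro x hx
    rw [Set.uIcc_of_le (by linarith [pi_pos])] at hx
    exact abs_of_nonpos (cos_nonpos_of_pi_div_two_le_of_le hx.1 (by linarith [hx.2]))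
  rw [h1, h2]
  simp
  norm_num

lemma en2_sq (z : R2) : en2 z = sqrt (z 0 ^ 2 + z 1 ^ 2) := by simp [en2, Fin.sum_univ_two]

lemma int_abs_dot (k : R2) : ∫ θ in (-π)..π, |k 0 * cos θ + k 1 * sin θ| = 4 * en2 k := by
  have key : ∀ θ, |k 0 * cos θ + k 1 * sin θ| = en2 k * |cos (θ - Complex.arg ⟨k 0, k 1⟩)| := by
    intro θ
    have hn : ‖(⟨k 0, k 1⟩ : ℂ)‖ = en2 k := by
      rw [en2_sq, Complex.norm_def, Complex.normSq_mk]; congr 1; ring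
    have h1 := Complex.norm_mul_cos_arg ⟨k 0, k 1⟩
    have h2 := Complex.norm_mul_sin_arg ⟨k 0, k 1⟩
    rw [hn] at h1 h2
    have hnn : 0 ≤ en2 k := Real.sqrt_nonneg _
    rw [← abs_of_nonneg hnn, ← abs_mul, cos_sub]
    congr 1
    simp only at h1 h2
    linear_combination (-cos θ) * h1 - sin θ * h2
  simp only [key]
  rw [intervalIntegral.integral_const_mul, int_abs_cos]; ring

lemma en2_polar {r : ℝ} (hr : 0 < r) (θ : ℝ) : en2 ![r * cos θ, r * sin θ] = r := by
  rw [en2_sq]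
  simp only [Matrix.cons_val_zero, Matrix.cons_val_one]
  rw [show (r * cos θ) ^ 2 + (r * sin θ) ^ 2 = r ^ 2 by linear_combination r ^ 2 * cos_sq_add_sin_sq θ]
  exact sqrt_sq hr.le

lemma lint_polar (f : R2 → ENNReal) (hf : Measurable f) :
    ∫⁻ z, f z = ∫⁻ θ in Set.Ioo (-π) π, ∫⁻ r in Set.Ioi (0:ℝ), ENNReal.ofReal r * f ![r * cos θ, r * sin θ] := by
  have h1 := (volume_preserving_finTwoArrow ℝ).symm.lintegral_comp hf
  rw [← h1, ← lintegral_comp_polarCoord_symm]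
  have hm : Measurable (fun p : ℝ × ℝ => ![p.1 * cos p.2, p.1 * sin p.2]) := by
    rw [measurable_pi_iff]
    intro i
    fin_cases i <;> simp <;> fun_prop
  rw [polarCoord_target, Measure.volume_eq_prod, setLIntegral_prod, lintegral_lintegral_swap]
  · rfl
  · apply Measurable.aemeasurable
    exact (by fun_prop : Measurable fun p : ℝ × ℝ => ENNReal.ofReal p.1).mul (hf.comp hm)
  · apply Measurable.aemeasurable
    exact (by fun_prop : Measurable fun p : ℝ × ℝ => ENNReal.ofReal p.1).mul (hf.comp hm)

lemma continuous_en2 : Continuous en2 := by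
  unfold en2; fun_prop

lemma lint_kernel (k : R2) :
    ∫⁻ z : R2, ENNReal.ofReal ((2 - 2 * cos (∑ i, k i * z i)) / en2 z ^ 3)
      = ENNReal.ofReal (4 * π * en2 k) := by
  have hm := continuous_en2.measurable
  rw [lint_polar _ (by fun_prop)]
  calc _ = ∫⁻ θ in Set.Ioo (-π) π, ENNReal.ofReal (π * |k 0 * cos θ + k 1 * sin θ|) := by
        refine setLIntegral_congr_fun measurableSet_Ioo fun θ _ => ?_
        rw [← lint_cos]
        refine setLIntegral_congr_fun measurableSet_Ioi fun r hr => ?_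
        have hr : 0 < r := hr
        rw [en2_polar hr, ← ENNReal.ofReal_mul hr.le]
        congr 1
        simp only [Fin.sum_univ_two, Matrix.cons_val_zero, Matrix.cons_val_one]
        rw [show k 0 * (r * cos θ) + k 1 * (r * sin θ) = (k 0 * cos θ + k 1 * sin θ) * r by ring]
        field_simp
    _ = ENNReal.ofReal (∫ θ in Set.Ioo (-π) π, π * |k 0 * cos θ + k 1 * sin θ|) := by
        rw [ofReal_integral_eq_lintegral_ofReal]
        · have : Continuous fun θ => π * |k 0 * cos θ + k 1 * sin θ| := by fun_prop
          exact (this.integrableOn_Icc).mono_set Set.Ioo_subset_Icc_self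
        · exact Filter.Eventually.of_forall fun θ => by have := pi_pos; positivity
    _ = _ := by
        rw [← integral_Ioc_eq_integral_Ioo, ← intervalIntegral.integral_of_le (by linarith [pi_pos]),
          intervalIntegral.integral_const_mul, int_abs_dot]
        congr 1; ring

lemma lint_bound : ∫⁻ z : R2, ENNReal.ofReal (1 / (1 + en2 z ^ 2) / en2 z) < ⊤ := by
  have hm := continuous_en2.measurable
  rw [lint_polar _ (by fun_prop)]
  have : ∀ θ, ∫⁻ r in Set.Ioi (0:ℝ), ENNReal.ofReal r * ENNReal.ofReal (1 / (1 + en2 ![r * cos θ, r * sin θ] ^ 2) / en2 ![r * cos θ, r * sin θ])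
    = ENNReal.ofReal (∫ r in Set.Ioi (0:ℝ), (1 + r ^ 2)⁻¹) := by
    intro θ
    rw [ofReal_integral_eq_lintegral_ofReal integrable_inv_one_add_sq.integrableOn
      (Filter.Eventually.of_forall fun r => by positivity)]
    refine setLIntegral_congr_fun measurableSet_Ioi fun r hr => ?_
    have hr : 0 < r := hr
    rw [en2_polar hr, ← ENNReal.ofReal_mul hr.le]
    congr 1
    field_simp
  simp only [this]
  rw [setLIntegral_const]
  exact ENNReal.mul_lt_top ENNReal.ofReal_lt_top (by simp)

section TorusPart

open UnitAddTorus
open scoped Pointwise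

/-- Normalised Haar measure on the circle, as in the multivariate Fourier file. -/
local instance msCircle : MeasureSpace UnitAddCircle := ⟨AddCircle.haarAddCircle⟩

local instance msHaar : Measure.IsAddHaarMeasure (volume : Measure UnitAddCircle) :=
  inferInstanceAs (Measure.IsAddHaarMeasure AddCircle.haarAddCircle)

local instance msProb : IsProbabilityMeasure (volume : Measure UnitAddCircle) :=
  inferInstanceAs (IsProbabilityMeasure AddCircle.haarAddCircle)

/-- Projection of the plane to the unit torus. -/
def projL (ℓ : ℝ) (x : R2) : UnitAddTorus (Fin 2) := fun i => ((x i / ℓ : ℝ) : UnitAddCircle)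

lemma projL_add (ℓ : ℝ) (x z : R2) : projL ℓ (x + z) = projL ℓ x + projL ℓ z := by
  funext i
  simp [projL, add_div]

lemma tor_int {E : Type*} [NormedAddCommGroup E] [NormedSpace ℝ E] {ℓ : ℝ} (hℓ : 0 < ℓ)
    (h : UnitAddTorus (Fin 2) → E) :
    ∫ x in cubeL ℓ, h (projL ℓ x) = ℓ ^ 2 • ∫ t, h t := by
  rw [integral_preimage h 0]
  have h1 := Measure.setIntegral_comp_smul_of_pos (volume : Measure R2) (fun x => h (projL ℓ x))
    {x : R2 | ∀ i, x i ∈ Set.Ioc ((0 : R2) i) ((0 : R2) i + 1)} hℓ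
  have h2 : ∀ x : R2, projL ℓ (ℓ • x) = fun i => ((x i : ℝ) : UnitAddCircle) := by
    intro x
    funext i
    simp only [projL, Pi.smul_apply, smul_eq_mul]
    rw [mul_div_cancel_left₀ _ hℓ.ne']
  simp only [h2] at h1
  rw [h1, smul_smul]
  have h3 : ℓ ^ 2 * (ℓ ^ Module.finrank ℝ R2)⁻¹ = 1 := by
    simp
    field_simp
  rw [h3, one_smul]
  apply setIntegral_congr_set
  have h4 : ℓ • {x : R2 | ∀ i, x i ∈ Set.Ioc ((0 : R2) i) ((0 : R2) i + 1)} =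
      Set.univ.pi fun _ => Set.Ioc (0:ℝ) ℓ := by
    ext x
    rw [Set.mem_smul_set_iff_inv_smul_mem₀ hℓ.ne']
    simp only [Set.mem_ofPred_eq, Set.mem_univ_pi, Pi.smul_apply, smul_eq_mul, Set.mem_Ioc, Pi.zero_apply, zero_add]
    refine forall_congr' fun i => ?_
    rw [inv_mul_le_iff₀ hℓ, mul_one]
    have : 0 < ℓ⁻¹ := inv_pos.2 hℓ
    simp [this]
  rw [h4]
  exact (Measure.univ_pi_Ico_ae_eq_Icc (μ := fun _ : Fin 2 => (volume : Measure ℝ))).trans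
    (Measure.univ_pi_Ioc_ae_eq_Icc (μ := fun _ : Fin 2 => (volume : Measure ℝ))).symm

/-- The lift of a periodic function to the torus. -/
def torG (ℓ : ℝ) (f : R2 → ℝ) (t : UnitAddTorus (Fin 2)) : ℝ :=
  f fun i => ℓ * (AddCircle.equivIoc (1:ℝ) 0 (t i) : ℝ)

lemma torG_proj {ℓ : ℝ} (hℓ : 0 < ℓ) {f : R2 → ℝ} (hper : PerL ℓ f) (x : R2) :
    torG ℓ f (projL ℓ x) = f x := by
  have h : ∀ i, ∃ n : ℤ, x i / ℓ - (AddCircle.equivIoc (1:ℝ) 0 (projL ℓ x i) : ℝ) = n := by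
    intro i
    have h1 : ((x i / ℓ - (AddCircle.equivIoc (1:ℝ) 0 (projL ℓ x i) : ℝ) : ℝ) : AddCircle (1:ℝ)) = 0 := by
      rw [AddCircle.coe_sub, AddCircle.coe_equivIoc]
      simp [projL]
    obtain ⟨n, hn⟩ := (AddCircle.coe_eq_zero_iff (1:ℝ)).1 h1
    exact ⟨n, by rw [← hn]; simp⟩
  choose n hn using h
  unfold torG
  rw [← hper _ n]
  congr 1
  funext i
  simp only [Pi.add_apply]
  rw [← hn i]
  field_simp
  ring

lemma torG_meas {ℓ : ℝ} {f : R2 → ℝ} (hf : Continuous f) : Measurable (torG ℓ f) := by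
  unfold torG
  refine hf.measurable.comp ?_
  rw [measurable_pi_iff]
  intro i
  exact ((measurable_subtype_coe.comp (AddCircle.measurableEquivIoc (1:ℝ) 0).measurable).comp
    (measurable_pi_apply i)).const_mul ℓ

lemma torG_bdd {ℓ : ℝ} (hℓ : 0 < ℓ) {f : R2 → ℝ} (hf : Continuous f) : ∃ M, ∀ t, |torG ℓ f t| ≤ M := by
  obtain ⟨M, hM⟩ := (isCompact_Icc (a := (0 : R2)) (b := fun _ => ℓ)).exists_bound_of_continuousOn
    hf.continuousOn
  refine ⟨M, fun t => hM _ ?_⟩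
  constructor
  · intro i
    have := (AddCircle.equivIoc (1:ℝ) 0 (t i)).2
    exact mul_nonneg hℓ.le this.1.le
  · intro i
    have := (AddCircle.equivIoc (1:ℝ) 0 (t i)).2
    have h2 : (AddCircle.equivIoc (1:ℝ) 0 (t i) : ℝ) ≤ 1 := by simpa using this.2
    simp only
    nlinarith

lemma parseval {g : UnitAddTorus (Fin 2) → ℂ} (hg : Measurable g) {M : ℝ} (hM : ∀ t, ‖g t‖ ≤ M) :
    HasSum (fun n => ‖mFourierCoeff g n‖ ^ 2) (∫ t, ‖g t‖ ^ 2) := by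
  have hL : MemLp g 2 volume := MemLp.of_bound hg.aestronglyMeasurable M (Filter.Eventually.of_forall hM)
  have h := hasSum_sq_mFourierCoeff (hL.toLp g)
  have h1 : ∀ n, mFourierCoeff (hL.toLp g) n = mFourierCoeff g n := by
    intro n
    apply integral_congr_ae
    filter_upwards [hL.coeFn_toLp] with t ht
    rw [ht]
  have h2 : ∫ t, ‖hL.toLp g t‖ ^ 2 = ∫ t, ‖g t‖ ^ 2 := by
    apply integral_congr_ae
    filter_upwards [hL.coeFn_toLp] with t ht
    rw [ht]
  simpa only [h1, h2] using h

lemma mFourier_add_arg (n : Fin 2 → ℤ) (s t : UnitAddTorus (Fin 2)) :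
    mFourier n (s + t) = mFourier n s * mFourier n t := by
  simp only [mFourier, ContinuousMap.coe_mk, ← Finset.prod_mul_distrib]
  refine Finset.prod_congr rfl fun i _ => ?_
  simp only [fourier_apply, Pi.add_apply, zsmul_add, AddCircle.toCircle_add, Circle.coe_mul]

lemma mFourier_proj (ℓ : ℝ) (n : Fin 2 → ℤ) (x : R2) :
    mFourier n (projL ℓ x) = Complex.exp (Complex.I * ((∑ i, (2 * π / ℓ * (n i : ℝ)) * x i : ℝ) : ℂ)) := by
  simp only [mFourier, ContinuousMap.coe_mk, projL, fourier_coe_apply]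
  rw [← Complex.exp_sum]
  congr 1
  push_cast
  rw [Finset.mul_sum]
  refine Finset.sum_congr rfl fun i _ => ?_
  simp only [div_one]
  ring

lemma coeff_eq {ℓ : ℝ} (hℓ : 0 < ℓ) {f : R2 → ℝ} (hper : PerL ℓ f) (n : Fin 2 → ℤ) :
    fourierCoeffL ℓ f (fun i => 2 * π / ℓ * (n i : ℝ))
      = (ℓ ^ 2 : ℝ) • mFourierCoeff (fun t => (torG ℓ f t : ℂ)) n := by
  unfold mFourierCoeff
  rw [← tor_int hℓ]
  unfold fourierCoeffL
  congr 1
  funext x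
  beta_reduce
  rw [torG_proj hℓ hper, mFourier_proj, smul_eq_mul]
  congr 2
  simp only [Pi.neg_apply]
  push_cast
  simp only [mul_neg, neg_mul, Finset.sum_neg_distrib]

lemma coeff_diff {G : UnitAddTorus (Fin 2) → ℂ} (hG : Measurable G) {M : ℝ} (hM : ∀ t, ‖G t‖ ≤ M)
    (s : UnitAddTorus (Fin 2)) (n : Fin 2 → ℤ) :
    mFourierCoeff (fun t => G (t + s) - G t) n = (mFourier n s - 1) * mFourierCoeff G n := by
  unfold mFourierCoeff
  have hb : ∀ t, ‖mFourier (-n) t‖ ≤ 1 := fun t => by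
    have := (mFourier (-n)).norm_coe_le_norm t
    rwa [mFourier_norm] at this
  have hI : Integrable (fun t => mFourier (-n) t • G t) := by
    refine Integrable.of_bound ((mFourier (-n)).continuous.measurable.smul hG).aestronglyMeasurable M
      (Filter.Eventually.of_forall fun t => ?_)
    rw [norm_smul]
    calc _ ≤ 1 * ‖G t‖ := by gcongr; exact hb t
      _ ≤ M := by rw [one_mul]; exact hM t
  have e1 : ∀ t, mFourier (-n) t • G (t + s) = mFourier n s * (mFourier (-n) (t + s) • G (t + s)) := by
    intro t
    rw [mFourier_add_arg, smul_eq_mul, smul_eq_mul]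
    have : mFourier n s * mFourier (-n) s = 1 := by
      rw [← mFourier_add]; simp [mFourier_zero]
    linear_combination (-(mFourier (-n) t * G (t + s))) * this
  simp only [smul_sub, e1]
  rw [integral_sub, integral_const_mul, integral_add_right_eq_self (fun t => mFourier (-n) t • G t) s]
  · ring
  · exact (hI.comp_add_right s).const_mul _
  · exact hI

lemma norm_exp_sub_one (u : ℝ) : ‖Complex.exp (Complex.I * (u : ℂ)) - 1‖ ^ 2 = 2 - 2 * cos u := by
  rw [mul_comm, Complex.exp_mul_I, ← Complex.ofReal_cos, ← Complex.ofReal_sin, ← Complex.normSq_eq_norm_sq, Complex.normSq_apply]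
  simp [Complex.cos_ofReal_re, Complex.sin_ofReal_re]
  nlinarith [sin_sq_add_cos_sq u]

lemma main_sum {ℓ : ℝ} (hℓ : 0 < ℓ) {f : R2 → ℝ} (hf : Continuous f) (hper : PerL ℓ f) (z : R2) :
    HasSum (fun n : Fin 2 → ℤ => (1 / ℓ ^ 2) * (‖fourierCoeffL ℓ f (fun i => 2 * π / ℓ * (n i : ℝ))‖ ^ 2 *
        (2 - 2 * cos (∑ i, (2 * π / ℓ * (n i : ℝ)) * z i))))
      (∫ x in cubeL ℓ, (f (x + z) - f x) ^ 2) := by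
  obtain ⟨M, hM⟩ := torG_bdd hℓ hf
  have hm : Measurable (fun t => (torG ℓ f t : ℂ)) := Complex.measurable_ofReal.comp (torG_meas hf)
  have hM' : ∀ t, ‖(torG ℓ f t : ℂ)‖ ≤ M := fun t => by simpa using hM t
  have hp := parseval (g := fun t => (torG ℓ f (t + projL ℓ z) : ℂ) - torG ℓ f t) (M := M + M)
    ((hm.comp (measurable_add_const _)).sub hm)
    (fun t => (norm_sub_le _ _).trans (add_le_add (hM' _) (hM' _)))
  have h1 : ∫ x in cubeL ℓ, (f (x + z) - f x) ^ 2 =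
      ℓ ^ 2 * ∫ t, ‖(torG ℓ f (t + projL ℓ z) : ℂ) - torG ℓ f t‖ ^ 2 := by
    rw [← smul_eq_mul, ← tor_int hℓ]
    congr 1
    funext x
    rw [← projL_add, torG_proj hℓ hper, torG_proj hℓ hper, ← Complex.ofReal_sub, Complex.norm_real,
      Real.norm_eq_abs, sq_abs]
  rw [h1]
  refine Eq.subst (motive := fun F => HasSum F _) (funext fun n => Eq.symm ?_) (hp.mul_left (ℓ ^ 2))
  rw [coeff_eq hℓ hper, coeff_diff hm hM', mFourier_proj, norm_mul, mul_pow, norm_exp_sub_one, norm_smul,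
    Real.norm_of_nonneg (by positivity)]
  field_simp

lemma f_bdd {ℓ : ℝ} (hℓ : 0 < ℓ) {f : R2 → ℝ} (hf : Continuous f) (hper : PerL ℓ f) :
    ∃ M, ∀ x, |f x| ≤ M := by
  obtain ⟨M, hM⟩ := torG_bdd hℓ hf
  exact ⟨M, fun x => by rw [← torG_proj hℓ hper]; exact hM _⟩

end TorusPart

lemma en2_nonneg (z : R2) : 0 ≤ en2 z := Real.sqrt_nonneg _

lemma norm_le_en2 (z : R2) : ‖z‖ ≤ en2 z := by
  rw [pi_norm_le_iff_of_nonneg (en2_nonneg z)]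
  intro i
  rw [Real.norm_eq_abs]
  apply Real.abs_le_sqrt
  exact Finset.single_le_sum (f := fun i => z i ^ 2) (fun i _ => sq_nonneg _) (Finset.mem_univ i)

lemma diff_bound {ℓ : ℝ} (hℓ : 0 < ℓ) {f : R2 → ℝ} (hf : ContDiff ℝ (⊤ : ℕ∞) f) (hper : PerL ℓ f) :
    ∃ C, 0 ≤ C ∧ ∀ x ∈ cubeL ℓ, ∀ z, (f (x + z) - f x) ^ 2 ≤ C * (en2 z ^ 2 / (1 + en2 z ^ 2)) := by
  obtain ⟨M, hM⟩ := f_bdd hℓ hf.continuous hper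
  have hfd : Continuous (fderiv ℝ f) := hf.continuous_fderiv (by simp)
  obtain ⟨L, hL⟩ := (isCompact_closedBall (0 : R2) (ℓ + 1)).exists_bound_of_continuousOn hfd.continuousOn
  refine ⟨2 * L ^ 2 + 8 * M ^ 2, by positivity, fun x hx z => ?_⟩
  have hρ := en2_nonneg z
  have hxn : ‖x‖ ≤ ℓ := by
    rw [pi_norm_le_iff_of_nonneg hℓ.le]
    intro i
    have := hx i (Set.mem_univ i)
    rw [Real.norm_of_nonneg this.1]
    exact this.2.le
  rw [← mul_div_assoc, le_div_iff₀ (by positivity)]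
  rcases le_or_gt (en2 z) 1 with h | h
  · have h1 := (convex_closedBall (0 : R2) (ℓ + 1)).norm_image_sub_le_of_norm_fderiv_le (𝕜 := ℝ) (f := f) (C := L)
      (x := x) (y := x + z) (fun y _ => (hf.differentiable (by simp)) y) hL
      (by rw [mem_closedBall_zero_iff]; linarith)
      (by rw [mem_closedBall_zero_iff]; linarith [norm_add_le x z, norm_le_en2 z])
    rw [add_sub_cancel_left, Real.norm_eq_abs] at h1
    have hL0 : 0 ≤ L := (norm_nonneg _).trans (hL 0 (by simp; linarith))
    have h2 : |f (x + z) - f x| ≤ L * en2 z := h1.trans (by gcongr; exact norm_le_en2 z)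
    have h3 : (f (x + z) - f x) ^ 2 ≤ (L * en2 z) ^ 2 := sq_le_sq' (by linarith [neg_abs_le (f (x + z) - f x)]) ((le_abs_self _).trans h2)
    have h4 : en2 z ^ 2 ≤ 1 := by nlinarith
    calc _ ≤ (L * en2 z) ^ 2 * (1 + 1) := by gcongr
      _ ≤ _ := by nlinarith [mul_nonneg (sq_nonneg M) (sq_nonneg (en2 z))]
  · have h1 := abs_le.1 (hM (x + z))
    have h2 := abs_le.1 (hM x)
    have h3 : (f (x + z) - f x) ^ 2 ≤ (2 * M) ^ 2 := sq_le_sq' (by linarith) (by linarith)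
    have h4 : 1 ≤ en2 z ^ 2 := by nlinarith
    calc _ ≤ (2 * M) ^ 2 * (en2 z ^ 2 + en2 z ^ 2) := by gcongr
      _ ≤ _ := by nlinarith [mul_nonneg (sq_nonneg L) (sq_nonneg (en2 z))]

lemma cubeL_meas (ℓ : ℝ) : MeasurableSet (cubeL ℓ) :=
  MeasurableSet.univ_pi fun _ => measurableSet_Ico

lemma cubeL_vol (ℓ : ℝ) : volume (cubeL ℓ) < ⊤ := by
  unfold cubeL
  rw [volume_pi_pi]
  simp

theorem stmt_5 (ℓ : ℝ) (hℓ : 0 < ℓ) (f : R2 → ℝ)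
    (hf : ContDiff ℝ (⊤ : ℕ∞) f) (hper : PerL ℓ f) :
    (1 / ℓ ^ 2) * ∑' n : Fin 2 → ℤ,
        en2 (fun i => 2 * π / ℓ * (n i : ℝ)) *
          ‖fourierCoeffL ℓ f (fun i => 2 * π / ℓ * (n i : ℝ))‖ ^ 2
      = (1 / (4 * π)) * ∫ x in cubeL ℓ, ∫ y : R2, (f x - f y) ^ 2 / en2 (x - y) ^ 3 := by
  have hc := hf.continuous
  have hcm := hc.measurable
  have hem := continuous_en2.measurable
  have hpi := pi_pos
  obtain ⟨C, hC0, hC⟩ := diff_bound hℓ hf hper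
  obtain ⟨M, hM⟩ := f_bdd hℓ hc hper
  have hfin : IsFiniteMeasure (volume.restrict (cubeL ℓ)) := ⟨by simpa using cubeL_vol ℓ⟩
  have hen : ∀ z : R2, en2 (-z) = en2 z := fun z => by simp [en2]
  set I : R2 → ENNReal := fun x => ∫⁻ y : R2, ENNReal.ofReal ((f x - f y) ^ 2 / en2 (x - y) ^ 3) with hI
  have hIm : Measurable I := by
    apply Measurable.lintegral_prod_right'
      (f := fun p : R2 × R2 => ENNReal.ofReal ((f p.1 - f p.2) ^ 2 / en2 (p.1 - p.2) ^ 3))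
    fun_prop
  have hIz : ∀ x, I x = ∫⁻ z : R2, ENNReal.ofReal ((f (x + z) - f x) ^ 2 / en2 z ^ 3) := by
    intro x
    rw [hI]
    simp only
    rw [← lintegral_add_left_eq_self _ x]
    congr 1
    funext z
    rw [show x - (x + z) = -z by abel, hen, show (f x - f (x + z)) ^ 2 = (f (x + z) - f x) ^ 2 by ring]
  have hIb : ∀ x ∈ cubeL ℓ, I x ≤ ENNReal.ofReal C * ∫⁻ z : R2, ENNReal.ofReal (1 / (1 + en2 z ^ 2) / en2 z) := by
    intro x hx
    rw [hIz, ← lintegral_const_mul _ (by fun_prop)]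
    refine lintegral_mono fun z => ?_
    rw [← ENNReal.ofReal_mul hC0]
    apply ENNReal.ofReal_le_ofReal
    rcases (en2_nonneg z).eq_or_lt with h | h
    · simp [← h]
    · calc _ ≤ C * (en2 z ^ 2 / (1 + en2 z ^ 2)) / en2 z ^ 3 := by gcongr; exact hC x hx z
        _ = _ := by field_simp
  have hIfin : ∀ x ∈ cubeL ℓ, I x < ⊤ := fun x hx =>
    (hIb x hx).trans_lt (ENNReal.mul_lt_top ENNReal.ofReal_lt_top lint_bound)
  have hTfin : ∫⁻ x in cubeL ℓ, I x < ⊤ := by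
    refine (setLIntegral_mono measurable_const hIb).trans_lt ?_
    rw [setLIntegral_const]
    exact ENNReal.mul_lt_top (ENNReal.mul_lt_top ENNReal.ofReal_lt_top lint_bound) (cubeL_vol ℓ)
  have hR : ∫ x in cubeL ℓ, ∫ y : R2, (f x - f y) ^ 2 / en2 (x - y) ^ 3 = (∫⁻ x in cubeL ℓ, I x).toReal := by
    rw [← integral_toReal hIm.aemeasurable
      ((ae_restrict_iff' (cubeL_meas ℓ)).2 (Filter.Eventually.of_forall hIfin))]
    congr 1
    funext x
    rw [integral_eq_lintegral_of_nonneg_ae]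
    · refine Filter.Eventually.of_forall fun y => ?_
      have := en2_nonneg (x - y)
      simp only [Pi.zero_apply]
      positivity
    · apply Measurable.aestronglyMeasurable
      fun_prop
  set A : (Fin 2 → ℤ) → ℝ := fun n => en2 (fun i => 2 * π / ℓ * (n i : ℝ)) *
          ‖fourierCoeffL ℓ f (fun i => 2 * π / ℓ * (n i : ℝ))‖ ^ 2 with hA
  have hA0 : ∀ n, 0 ≤ A n := fun n => mul_nonneg (en2_nonneg _) (sq_nonneg _)
  have hT : ∫⁻ x in cubeL ℓ, I x = ∑' n, ENNReal.ofReal (4 * π / ℓ ^ 2 * A n) := by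
    simp only [hIz]
    rw [lintegral_lintegral_swap]
    swap
    · apply Measurable.aemeasurable
      unfold Function.uncurry
      fun_prop
    have h1 : ∀ z : R2, ∫⁻ x in cubeL ℓ, ENNReal.ofReal ((f (x + z) - f x) ^ 2 / en2 z ^ 3) =
        ∑' n : Fin 2 → ℤ, ENNReal.ofReal ((1 / ℓ ^ 2) * ‖fourierCoeffL ℓ f (fun i => 2 * π / ℓ * (n i : ℝ))‖ ^ 2) *
          ENNReal.ofReal ((2 - 2 * cos (∑ i, (2 * π / ℓ * (n i : ℝ)) * z i)) / en2 z ^ 3) := by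
      intro z
      have hs := (main_sum hℓ hc hper z).div_const (en2 z ^ 3)
      have hz := en2_nonneg z
      rw [← ofReal_integral_eq_lintegral_ofReal, integral_div, ← hs.tsum_eq,
        ENNReal.ofReal_tsum_of_nonneg _ hs.summable]
      · congr 1
        funext n
        rw [← ENNReal.ofReal_mul (by positivity)]
        congr 1
        ring
      · intro n
        have := cos_le_one (∑ i, (2 * π / ℓ * (n i : ℝ)) * z i)
        have : 0 ≤ 2 - 2 * cos (∑ i, (2 * π / ℓ * (n i : ℝ)) * z i) := by linarith
        positivity
      · apply Integrable.div_const
        refine Integrable.of_bound (by apply Measurable.aestronglyMeasurable; fun_prop) ((2 * M) ^ 2)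
          (Filter.Eventually.of_forall fun x => ?_)
        rw [Real.norm_of_nonneg (sq_nonneg _)]
        have h1 := abs_le.1 (hM (x + z))
        have h2 := abs_le.1 (hM x)
        exact sq_le_sq' (by linarith) (by linarith)
      · refine Filter.Eventually.of_forall fun x => ?_
        simp only [Pi.zero_apply]
        positivity
    simp only [h1]
    rw [lintegral_tsum]
    swap
    · intro n
      apply Measurable.aemeasurable
      fun_prop
    congr 1
    funext n
    rw [lintegral_const_mul _ (by fun_prop), lint_kernel, ← ENNReal.ofReal_mul (by positivity)]
    congr 1
    rw [hA]
    simp only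
    ring
  rw [hR, hT, ENNReal.tsum_toReal_eq (fun n => ENNReal.ofReal_ne_top)]
  have : ∀ n, (ENNReal.ofReal (4 * π / ℓ ^ 2 * A n)).toReal = 4 * π / ℓ ^ 2 * A n := fun n =>
    ENNReal.toReal_ofReal (mul_nonneg (by positivity) (hA0 n))
  simp only [this]
  rw [tsum_mul_left]
  field_simp
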